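/- For every L > 0, every n ∈ ℕ, and every ε > 0, there exists δ > 0 with the following property. Let B and C be unital C*-algebras, let π : B → C be a surjective unital *-homomorphism, and let x_1, …, x_n ∈ B be contractions. Let w be a unitary in C, and suppose there exists a continuous path u : [0,1] → C of unitaries in C with u 0 = 1, u 1 = w, whose total variation (rectifiable length) on [0,1] is at most L, and which satisfies ‖π(x_i) · (u t) − (u t) · π(x_i)‖ < δ for all i = 1, …, n and all t ∈ [0,1]. Then there exists a unitary v ∈ B with π(v) = w and ‖x_i v − v x_i‖ < ε for all i = 1, …, n. -/

import Mathlib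

/-- Cauchy–Schwarz for finite sums in a C⋆-algebra. -/
lemma norm_sum_mul_sq_le {B ι : Type*} [CStarAlgebra B] [Fintype ι] (a b : ι → B) :
    ‖∑ i, a i * b i‖ ^ 2 ≤ ‖∑ i, a i * star (a i)‖ * ‖∑ i, star (b i) * b i‖ := by
  let _ : PartialOrder B := CStarAlgebra.spectralOrder B
  have : StarOrderedRing B := CStarAlgebra.spectralOrderedRing B
  let E := WithCStarModule B (ι → B)
  let v : E := (WithCStarModule.equiv B (ι → B)).symm (fun i ↦ star (b i))
  let w : E := (WithCStarModule.equiv B (ι → B)).symm a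
  have h := CStarModule.norm_inner_le (A := B) E (x := v) (y := w)
  have hv : ‖v‖ ^ 2 = ‖∑ i, star (b i) * b i‖ := by
    rw [WithCStarModule.pi_norm_sq]
    simp [v, WithCStarModule.inner_def]
  have hw : ‖w‖ ^ 2 = ‖∑ i, a i * star (a i)‖ := by
    rw [WithCStarModule.pi_norm_sq]
    simp [w, WithCStarModule.inner_def]
  have hvw : inner B v w = ∑ i, a i * b i := by
    rw [WithCStarModule.pi_inner]
    simp [v, w, WithCStarModule.inner_def]
  rw [hvw] at h
  rw [← hv, ← hw]
  calc _ ≤ (‖v‖ * ‖w‖) ^ 2 := by gcongr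
    _ = _ := by ring

lemma StarAlgHom.continuous_of_cstarAlgebra {B C : Type*} [CStarAlgebra B] [CStarAlgebra C]
    (π : B →⋆ₐ[ℂ] C) : Continuous π :=
  AddMonoidHomClass.continuous_of_bound π 1 fun a ↦ by
    simpa using NonUnitalStarAlgHom.norm_apply_le π a

/-- The kernel of a star homomorphism of C⋆-algebras, as a C⋆-subalgebra. -/
def StarAlgHom.kerSubalgebra {B C : Type*} [CStarAlgebra B] [CStarAlgebra C] (π : B →⋆ₐ[ℂ] C) :
    NonUnitalStarSubalgebra ℂ B where
  carrier := {b | π b = 0}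
  add_mem' {a b} ha hb := by simp_all
  zero_mem' := by simp
  mul_mem' {a b} ha hb := by simp_all
  smul_mem' c a ha := by simp_all
  star_mem' {a} ha := by simp_all [map_star]

lemma StarAlgHom.isClosed_kerSubalgebra {B C : Type*} [CStarAlgebra B] [CStarAlgebra C]
    (π : B →⋆ₐ[ℂ] C) : IsClosed (π.kerSubalgebra : Set B) :=
  isClosed_singleton.preimage π.continuous_of_cstarAlgebra

open Filter Topology in
/-- In a C⋆-algebra every `a ≥ 0` with `‖a‖ < 1` lies below an element of the same kind that almost
acts as a unit on finitely many given elements. -/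
lemma exists_ge_almost_unit {A ι : Type*} [NonUnitalCStarAlgebra A] [PartialOrder A]
    [StarOrderedRing A] [Finite ι] (y : ι → A) {η : ℝ} (hη : 0 < η) {e : A}
    (he : 0 ≤ e) (he1 : ‖e‖ < 1) :
    ∃ f : A, 0 ≤ f ∧ ‖f‖ < 1 ∧ e ≤ f ∧ ∀ i, ‖y i - f * y i‖ ≤ η ∧ ‖y i - y i * f‖ ≤ η := by
  have hb := CStarAlgebra.hasBasis_approximateUnit A
  have hu := CStarAlgebra.increasingApproximateUnit A
  have h1 : ∀ᶠ f in CStarAlgebra.approximateUnit A, e ≤ f := by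
    filter_upwards [hb.mem_of_mem ⟨he, he1⟩] with f hf using hf.1
  have h2 : ∀ᶠ f in CStarAlgebra.approximateUnit A, ∀ i,
      ‖y i - f * y i‖ ≤ η ∧ ‖y i - y i * f‖ ≤ η := by
    rw [eventually_all]
    intro i
    filter_upwards [(hu.tendsto_mul_right (y i)).eventually (Metric.closedBall_mem_nhds _ hη),
      (hu.tendsto_mul_left (y i)).eventually (Metric.closedBall_mem_nhds _ hη)] with f hf hf'
    rw [← dist_eq_norm, ← dist_eq_norm, dist_comm, dist_comm (y i)]
    exact ⟨hf, hf'⟩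
  obtain ⟨f, ⟨hf, hf1⟩, hs⟩ := hb.mem_iff.1 (h1.and h2)
  have := hs ⟨le_refl f, by simpa using hf1.le⟩
  exact ⟨f, hf, hf1, this.1, this.2⟩

/-- An increasing sequence in the kernel of a star homomorphism that is almost a unit for finitely
many elements of the kernel, each term being almost a unit for the multiples of the previous one by
finitely many elements of the algebra. -/
lemma exists_seq_almost_unit {B C ι κ : Type*} [CStarAlgebra B] [CStarAlgebra C]
    (π : B →⋆ₐ[ℂ] C) [Finite ι] [Finite κ] (y : ι → B) (a : κ → B) (ha : ∀ j, π (a j) = 0)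
    {η : ℝ} (hη : 0 < η) :
    ∃ e b : ℕ → B, (∀ k, π (e k) = 0) ∧ (∀ k, IsSelfAdjoint (e k)) ∧ (∀ k, ‖e k‖ ≤ 1) ∧
      (∀ k, e (k + 1) - e k = star (b k) * b k) ∧
      (∀ k i, ‖e k * y i * (1 - e (k + 1))‖ ≤ η) ∧
      (∀ k j, ‖(1 - e k) * a j‖ ≤ η ∧ ‖a j * (1 - e k)‖ ≤ η) := by
  have : IsClosed (π.kerSubalgebra : Set B) := π.isClosed_kerSubalgebra
  let A := π.kerSubalgebra
  let _ : NonUnitalCStarAlgebra A := NonUnitalStarSubalgebra.nonUnitalCStarAlgebra _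
  let _ : PartialOrder A := CStarAlgebra.spectralOrder A
  have : StarOrderedRing A := CStarAlgebra.spectralOrderedRing A
  let P := {e : A // 0 ≤ e ∧ ‖e‖ < 1}
  have step (e : P) : ∃ f : P, e.1 ≤ f.1 ∧ (∀ i, ‖(e.1 : B) * y i * (1 - (f.1 : B))‖ ≤ η) ∧
      (∀ j, ‖(1 - (f.1 : B)) * a j‖ ≤ η ∧ ‖a j * (1 - (f.1 : B))‖ ≤ η) := by
    have hm (i : ι) : (e.1 : B) * y i ∈ A := by
      have : π (e.1 : B) = 0 := e.1.2
      change π _ = 0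
      simp [this]
    obtain ⟨f, hf0, hf1, hef, hf⟩ := exists_ge_almost_unit
      (Sum.elim (fun i ↦ (⟨_, hm i⟩ : A)) (fun j ↦ (⟨a j, ha j⟩ : A))) hη e.2.1 e.2.2
    refine ⟨⟨f, hf0, hf1⟩, hef, fun i ↦ ?_, fun j ↦ ?_⟩
    · rw [mul_sub, mul_one]
      exact (hf (.inl i)).2
    · rw [mul_sub, mul_one, sub_mul, one_mul]
      exact hf (.inr j)
  choose g hg1 hg2 hg3 using step
  let s : ℕ → P := fun k ↦ g^[k + 1] ⟨0, le_rfl, by simp⟩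
  have hs (k : ℕ) : s (k + 1) = g (s k) := Function.iterate_succ_apply' g _ _
  have hs' (k : ℕ) : ∃ p, s k = g p := ⟨_, Function.iterate_succ_apply' g _ _⟩
  have hd (k : ℕ) : ∃ b : A, (s (k + 1)).1 - (s k).1 = star b * b :=
    CStarAlgebra.nonneg_iff_eq_star_mul_self.1 (by rw [hs]; exact sub_nonneg.2 (hg1 _))
  choose b hb using hd
  refine ⟨fun k ↦ (s k).1, fun k ↦ b k, fun k ↦ (s k).1.2, fun k ↦ ?_, fun k ↦ (s k).2.2.le,
    fun k ↦ congrArg Subtype.val (hb k), fun k i ↦ ?_, fun k j ↦ ?_⟩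
  · exact congrArg Subtype.val (IsSelfAdjoint.of_nonneg (s k).2.1).star_eq
  · simp only [hs]
    exact hg2 _ i
  · obtain ⟨p, hp⟩ := hs' k
    simp only [hp]
    exact hg3 _ j

lemma norm_sum_fin_le {B : Type*} [SeminormedAddCommGroup B] {N : ℕ} {f : Fin N → B} {r : ℝ}
    (h : ∀ k, ‖f k‖ ≤ r) : ‖∑ k, f k‖ ≤ N * r :=
  (norm_sum_le_of_le Finset.univ fun k _ ↦ h k).trans (by simp)

/-- Averaging an increasing sequence of almost units makes it almost commute with a contraction. -/
lemma norm_sum_mul_one_sub_le {B : Type*} [CStarAlgebra B] {e b : ℕ → B} {y : B} {η : ℝ}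
    (he : ∀ k, ‖e k‖ ≤ 1) (hb : ∀ k, e (k + 1) - e k = star (b k) * b k) (hy1 : ‖y‖ ≤ 1)
    (hy : ∀ k, ‖e k * y * (1 - e (k + 1))‖ ≤ η) (N : ℕ) :
    ‖∑ k : Fin N, e k * y * (1 - e k)‖ ≤ 2 * √N + N * η := by
  have hbk (k : ℕ) : ‖b k‖ ^ 2 ≤ 2 := by
    rw [sq, ← CStarRing.norm_star_mul_self, ← hb]
    linarith [norm_sub_le (e (k + 1)) (e k), he k, he (k + 1)]
  have hsum : ∑ k : Fin N, e k * y * (1 - e k) =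
      ∑ k : Fin N, (e k * y * star (b k)) * b k + ∑ k : Fin N, e k * y * (1 - e (k + 1)) := by
    rw [← Finset.sum_add_distrib]
    refine Finset.sum_congr rfl fun k _ ↦ ?_
    rw [mul_assoc _ (star (b k)), ← hb, ← mul_add]
    congr 1
    abel
  have h1 : ‖∑ k : Fin N, star (b k) * b k‖ ≤ 2 := by
    simp_rw [← hb]
    rw [Fin.sum_univ_eq_sum_range (fun k ↦ e (k + 1) - e k), Finset.sum_range_sub]
    linarith [norm_sub_le (e N) (e 0), he N, he 0]
  have h2 : ‖∑ k : Fin N, (e k * y * star (b k)) * star (e k * y * star (b k))‖ ≤ N * 2 := by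
    refine norm_sum_fin_le fun k ↦ ?_
    have : ‖e k * y * star (b k)‖ ≤ 1 * 1 * ‖b k‖ := by
      refine (norm_mul_le _ _).trans ?_
      rw [norm_star]
      gcongr
      exact (norm_mul_le _ _).trans (by gcongr; exact he _)
    rw [CStarRing.norm_self_mul_star]
    nlinarith [hbk k, norm_nonneg (e k * y * star (b k)), norm_nonneg (b k)]
  have h3 := norm_sum_mul_sq_le (fun k : Fin N ↦ e k * y * star (b k)) (fun k : Fin N ↦ b k)
  have h4 : ‖∑ k : Fin N, (e k * y * star (b k)) * b k‖ ≤ 2 * √N := by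
    refine abs_le_of_sq_le_sq' ?_ (by positivity) |>.2
    calc _ ≤ _ := h3
      _ ≤ (N * 2) * 2 := by gcongr
      _ = _ := by rw [mul_pow, Real.sq_sqrt (by positivity)]; ring
  have h5 : ‖∑ k : Fin N, e k * y * (1 - e (k + 1))‖ ≤ N * η :=
    norm_sum_fin_le fun k ↦ hy k
  rw [hsum]
  exact (norm_add_le _ _).trans (add_le_add h4 h5)

/-- The kernel of a star homomorphism of C⋆-algebras contains a quasicentral approximate unit. -/
lemma exists_quasicentral {B C ι κ : Type*} [CStarAlgebra B] [CStarAlgebra C]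
    (π : B →⋆ₐ[ℂ] C) [Finite ι] [Finite κ] (x : ι → B) (hx : ∀ i, ‖x i‖ ≤ 1)
    (a : κ → B) (ha : ∀ j, π (a j) = 0) {η : ℝ} (hη : 0 < η) :
    ∃ e : B, π e = 0 ∧ IsSelfAdjoint e ∧ ‖e‖ ≤ 1 ∧ (∀ i, ‖x i * e - e * x i‖ ≤ η) ∧
      (∀ j, ‖(1 - e) * a j‖ ≤ η ∧ ‖a j * (1 - e)‖ ≤ η) := by
  obtain ⟨e, b, he0, hesa, he1, hb, hy, hea⟩ := exists_seq_almost_unit π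
    (Sum.elim x (fun i ↦ star (x i))) a ha (η := η / 4) (by positivity)
  obtain ⟨N, hN⟩ := exists_nat_gt ((8 / η) ^ 2)
  have hN0 : (0 : ℝ) < N := lt_of_le_of_lt (by positivity) hN
  have hsq : 8 / η ≤ √N := Real.le_sqrt_of_sq_le hN.le
  have hsN : 2 * √N ≤ N * (η / 4) := by
    have h8 : 8 ≤ √N * η := by rwa [div_le_iff₀ hη] at hsq
    have : √N * √N = N := Real.mul_self_sqrt hN0.le
    nlinarith [Real.sqrt_nonneg (N : ℝ)]
  have hNinv : ‖((N : ℝ)⁻¹)‖ = (N : ℝ)⁻¹ := by simp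
  have havg (z : B) (r : ℝ) (hz : ‖z‖ ≤ N * r) : ‖(N : ℝ)⁻¹ • z‖ ≤ r := by
    rw [norm_smul, hNinv, inv_mul_le_iff₀ hN0]
    exact hz
  have hone : (1 : B) = (N : ℝ)⁻¹ • ∑ _k : Fin N, (1 : B) := by
    rw [Finset.sum_const, Finset.card_univ, Fintype.card_fin, ← Nat.cast_smul_eq_nsmul ℝ, smul_smul,
      inv_mul_cancel₀ hN0.ne', one_smul]
  refine ⟨(N : ℝ)⁻¹ • ∑ k : Fin N, e k, ?_, ?_, ?_, fun i ↦ ?_, fun j ↦ ?_⟩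
  · have : (N : ℝ)⁻¹ • ∑ k : Fin N, e k = ((N : ℝ)⁻¹ : ℂ) • ∑ k : Fin N, e k := by
      rw [← Complex.ofReal_inv, Complex.coe_smul]
    rw [this, map_smul, map_sum]
    simp [he0]
  · exact (IsSelfAdjoint.all _).smul (isSelfAdjoint_sum _ fun k _ ↦ hesa k)
  · exact havg _ _ (norm_sum_fin_le fun k ↦ he1 k)
  · have h1 := norm_sum_mul_one_sub_le he1 hb (hx i) (fun k ↦ hy k (.inl i)) N
    have h2 := norm_sum_mul_one_sub_le he1 hb ((norm_star (x i)).trans_le (hx i))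
      (fun k ↦ hy k (.inr i)) N
    rw [← norm_star] at h2
    have h3 : x i * (N : ℝ)⁻¹ • ∑ k : Fin N, e k - ((N : ℝ)⁻¹ • ∑ k : Fin N, e k) * x i =
        (N : ℝ)⁻¹ • (star (∑ k : Fin N, e k * star (x i) * (1 - e k)) -
          ∑ k : Fin N, e k * x i * (1 - e k)) := by
      rw [mul_smul_comm, smul_mul_assoc, ← smul_sub, Finset.mul_sum, Finset.sum_mul, star_sum,
        ← Finset.sum_sub_distrib, ← Finset.sum_sub_distrib]
      congr 1
      refine Finset.sum_congr rfl fun k _ ↦ ?_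
      simp only [star_mul, star_sub, star_one, star_star, (hesa k).star_eq]
      noncomm_ring
    rw [h3]
    refine havg _ _ ((norm_sub_le _ _).trans ?_)
    linarith
  · constructor
    · rw [hone, ← smul_sub, smul_mul_assoc, ← Finset.sum_sub_distrib, Finset.sum_mul]
      exact havg _ _ (norm_sum_fin_le fun k ↦ (hea k j).1.trans (by linarith))
    · rw [hone, ← smul_sub, mul_smul_comm, ← Finset.sum_sub_distrib, Finset.mul_sum]
      exact havg _ _ (norm_sum_fin_le fun k ↦ (hea k j).2.trans (by linarith))

/-- A selfadjoint element in the range of a star homomorphism can be truncated upstairs. -/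
lemma IsSelfAdjoint.exists_map_eq_norm_le {B C : Type*} [CStarAlgebra B] [CStarAlgebra C]
    (π : B →⋆ₐ[ℂ] C) {y : B} (hy : IsSelfAdjoint y) :
    ∃ z : B, π z = π y ∧ ‖z‖ ≤ ‖π y‖ := by
  set r := ‖π y‖ with hr
  have hr0 : 0 ≤ r := norm_nonneg _
  let f : ℝ → ℝ := fun t ↦ max (-r) (min t r)
  have hf : Continuous f := by fun_prop
  refine ⟨cfc f y, ?_, norm_cfc_le hr0 fun t _ ↦ ?_⟩
  · rw [StarAlgHomClass.map_cfc (S := ℂ) π f y hf.continuousOn π.continuous_of_cstarAlgebra hy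
      (hy.map π)]
    refine (cfc_congr fun t ht ↦ ?_).trans (cfc_id' ℝ (π y) (hy.map π))
    have h1 : ‖t‖ ≤ r := by
      rcases subsingleton_or_nontrivial C with h | h
      · simp [spectrum.of_subsingleton] at ht
      · exact spectrum.norm_le_norm_of_mem ht
    have h2 := abs_le.1 h1
    simp [f, h2.1, h2.2]
  · exact abs_le.2 ⟨le_max_left _ _, max_le (by linarith) (min_le_right _ _)⟩

lemma exists_map_eq_norm_le_two_mul {B C : Type*} [CStarAlgebra B] [CStarAlgebra C]
    (π : B →⋆ₐ[ℂ] C) (y : B) : ∃ z : B, π z = π y ∧ ‖z‖ ≤ 2 * ‖π y‖ := by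
  obtain ⟨z₁, h₁, h₁'⟩ := (realPart y).2.exists_map_eq_norm_le π
  obtain ⟨z₂, h₂, h₂'⟩ := (imaginaryPart y).2.exists_map_eq_norm_le π
  have hsm (c : ℝ) (w : B) : π (c • w) = c • π w := by
    rw [← Complex.coe_smul, map_smul, Complex.coe_smul]
  have hre : π (realPart y : B) = (realPart (π y) : C) := by
    simp [realPart_apply_coe, hsm, map_star]
  have him : π (imaginaryPart y : B) = (imaginaryPart (π y) : C) := by
    simp [imaginaryPart_apply_coe, hsm, map_star]
  refine ⟨z₁ + Complex.I • z₂, ?_, ?_⟩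
  · rw [map_add, map_smul, h₁, h₂, ← map_smul, ← map_add, realPart_add_I_smul_imaginaryPart]
  · rw [hre] at h₁'
    rw [him] at h₂'
    have h3 := h₁'.trans (realPart.norm_le (π y))
    have h4 := h₂'.trans (imaginaryPart.norm_le (π y))
    refine (norm_add_le _ _).trans ?_
    rw [norm_smul, Complex.norm_I]
    linarith

/-- A selfadjoint element of the range of a star homomorphism lifts to a selfadjoint element whose
commutators with given contractions are controlled by the commutators downstairs. -/
lemma exists_selfAdjoint_lift {B C ι : Type*} [CStarAlgebra B] [CStarAlgebra C] [Finite ι]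
    {π : B →⋆ₐ[ℂ] C} (hπ : Function.Surjective π) {x : ι → B} (hx : ∀ i, ‖x i‖ ≤ 1)
    {h : C} (hh : IsSelfAdjoint h) {δ : ℝ} (hδ : ∀ i, ‖π (x i) * h - h * π (x i)‖ ≤ δ)
    {η : ℝ} (hη : 0 < η) :
    ∃ k : B, π k = h ∧ IsSelfAdjoint k ∧ ∀ i, ‖x i * k - k * x i‖ ≤ 4 * δ + η := by
  obtain ⟨l, hl⟩ := hπ h
  let k : B := realPart l
  have hk : IsSelfAdjoint k := (realPart l).2
  have hπk : π k = h := by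
    simp only [k, realPart_apply_coe]
    rw [← Complex.coe_smul, map_smul, map_add, map_star, hl, hh.star_eq, ← two_smul ℂ h, smul_smul]
    simp
  let y : ι → B := fun i ↦ x i * k - k * x i
  have hy (i : ι) : ‖π (y i)‖ ≤ δ := by
    simpa [y, hπk] using hδ i
  choose z hz hz' using fun i ↦ exists_map_eq_norm_le_two_mul π (y i)
  obtain ⟨e, he0, hesa, he1, hex, hea⟩ := exists_quasicentral π x hx (fun i ↦ y i - z i)
    (fun i ↦ by simp [hz]) (η := η / (1 + ‖k‖)) (by positivity)
  set η' := η / (1 + ‖k‖) with hη'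
  have hηη' : η' + ‖k‖ * η' = η := by
    rw [hη']
    field_simp
  have hone : ‖1 - e‖ ≤ 2 := by
    have : ‖(1 : B)‖ ≤ 1 := by
      nontriviality B
      exact CStarRing.norm_one.le
    linarith [norm_sub_le 1 e]
  refine ⟨(2⁻¹ : ℂ) • ((1 - e) * k + k * (1 - e)), ?_, ?_, fun i ↦ ?_⟩
  · simp only [map_smul, map_add, map_mul, map_sub, map_one, he0, hπk, sub_zero, one_mul, mul_one]
    rw [← two_smul ℂ h, smul_smul]
    simp
  · simp [IsSelfAdjoint, hk.star_eq, hesa.star_eq, add_comm]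
  · have key : x i * (2⁻¹ : ℂ) • ((1 - e) * k + k * (1 - e)) -
        ((2⁻¹ : ℂ) • ((1 - e) * k + k * (1 - e))) * x i =
        (2⁻¹ : ℂ) • (((1 - e) * z i + z i * (1 - e)) +
          ((1 - e) * (y i - z i) + (y i - z i) * (1 - e)) -
          ((x i * e - e * x i) * k + k * (x i * e - e * x i))) := by
      rw [mul_smul_comm, smul_mul_assoc, ← smul_sub]
      simp only [y]
      congr 1
      noncomm_ring
    rw [key, norm_smul]
    have hzi : ‖z i‖ ≤ 2 * δ := (hz' i).trans (by linarith [hy i])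
    have h1 : ‖(1 - e) * z i‖ ≤ 2 * (2 * δ) := (norm_mul_le _ _).trans (by gcongr)
    have h2 : ‖z i * (1 - e)‖ ≤ 2 * δ * 2 :=
      (norm_mul_le _ _).trans (by gcongr; exact (norm_nonneg _).trans hzi)
    have h3 : ‖(x i * e - e * x i) * k‖ ≤ η' * ‖k‖ :=
      (norm_mul_le _ _).trans (by gcongr; exact hex i)
    have h4 : ‖k * (x i * e - e * x i)‖ ≤ ‖k‖ * η' :=
      (norm_mul_le _ _).trans (by gcongr; exact hex i)
    have h5 := norm_sub_le (((1 - e) * z i + z i * (1 - e)) +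
          ((1 - e) * (y i - z i) + (y i - z i) * (1 - e)))
          ((x i * e - e * x i) * k + k * (x i * e - e * x i))
    have h6 := norm_add_le ((1 - e) * z i + z i * (1 - e))
      ((1 - e) * (y i - z i) + (y i - z i) * (1 - e))
    have h7 := norm_add_le ((1 - e) * z i) (z i * (1 - e))
    have h8 := norm_add_le ((1 - e) * (y i - z i)) ((y i - z i) * (1 - e))
    have h9 := norm_add_le ((x i * e - e * x i) * k) (k * (x i * e - e * x i))
    have h10 := hea i
    have : ‖(2⁻¹ : ℂ)‖ = 2⁻¹ := by simp
    rw [this]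
    linarith

lemma norm_commutator_inverse_le {B : Type*} [NormedRing B] {r t : B} (hrt : r * t = 1)
    (htr : t * r = 1) (hr : ‖r‖ ≤ 1) (x : B) : ‖x * r - r * x‖ ≤ ‖x * t - t * x‖ := by
  have : x * r - r * x = -(r * (x * t - t * x) * r) := by
    rw [mul_sub, sub_mul, mul_assoc r (x * t), mul_assoc x, htr, ← mul_assoc r t, hrt]
    simp
  rw [this, norm_neg]
  calc _ ≤ ‖r‖ * ‖x * t - t * x‖ * ‖r‖ :=
        (norm_mul_le _ _).trans (by gcongr; exact norm_mul_le _ _)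
    _ ≤ 1 * ‖x * t - t * x‖ * 1 := by gcongr
    _ = _ := by simp

lemma norm_le_one_of_mem_unitary {B : Type*} [CStarAlgebra B] {u : B} (hu : u ∈ unitary B) :
    ‖u‖ ≤ 1 := by
  nontriviality B
  exact (CStarRing.norm_of_mem_unitary hu).le

/-- The Cayley transform of a selfadjoint element. -/
lemma IsSelfAdjoint.exists_cayley {B : Type*} [CStarAlgebra B] {k : B} (hk : IsSelfAdjoint k) :
    ∃ r : B, r * (1 - Complex.I • k) = 1 ∧ (1 - Complex.I • k) * r = 1 ∧ ‖r‖ ≤ 1 ∧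
      (2 : ℂ) • r - 1 ∈ unitary B := by
  have hunit : IsUnit (1 - Complex.I • k) := by
    have h1 : -Complex.I ∉ spectrum ℂ k := fun h ↦ by
      have := hk.im_eq_zero_of_mem_spectrum h
      simp at this
    have h2 := (spectrum.notMem_iff.1 h1).smul (Units.mk0 (Complex.I) Complex.I_ne_zero)
    convert h2 using 1
    rw [Units.smul_def, Units.val_mk0, smul_sub, Algebra.algebraMap_eq_smul_one, smul_smul]
    simp
  obtain ⟨t, ht⟩ := hunit
  have h1 : (↑t⁻¹ : B) * (1 - Complex.I • k) = 1 := by rw [← ht, Units.inv_mul]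
  have h2 : (1 - Complex.I • k) * (↑t⁻¹ : B) = 1 := by rw [← ht, Units.mul_inv]
  set r : B := ↑t⁻¹
  have hs : star (1 - Complex.I • k) = 1 + Complex.I • k := by
    simp [hk.star_eq]
  have h3 : star r * (1 + Complex.I • k) = 1 := by
    rw [← hs, ← star_mul, h2, star_one]
  have h4 : (1 + Complex.I • k) * star r = 1 := by
    rw [← hs, ← star_mul, h1, star_one]
  have h5 : (2 : ℂ) • (star r * r) = star r + r := by
    calc _ = star r * ((1 - Complex.I • k) * r) + star r * (1 + Complex.I • k) * r := by
          rw [two_smul]; noncomm_ring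
      _ = _ := by rw [h2, h3]; simp
  have h6 : (2 : ℂ) • (r * star r) = star r + r := by
    calc _ = r * (1 - Complex.I • k) * star r + r * ((1 + Complex.I • k) * star r) := by
          rw [two_smul]; noncomm_ring
      _ = _ := by rw [h1, h4]; simp
  have hu : (2 : ℂ) • r - 1 ∈ unitary B := by
    rw [Unitary.mem_iff]
    simp only [star_sub, star_smul, star_one, RCLike.star_def, map_ofNat, sub_mul, mul_sub,
      smul_mul_smul_comm, mul_one, one_mul]
    rw [mul_smul, mul_smul, h5, h6, smul_add]
    constructor <;> abel
  refine ⟨r, h1, h2, ?_, hu⟩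
  have h7 : r = (2⁻¹ : ℂ) • (((2 : ℂ) • r - 1) + 1) := by
    simp [smul_smul]
  rw [h7, norm_smul]
  have : ‖(2⁻¹ : ℂ)‖ = 2⁻¹ := by simp
  rw [this]
  linarith [norm_add_le ((2 : ℂ) • r - 1) 1, norm_le_one_of_mem_unitary hu,
    norm_le_one_of_mem_unitary (one_mem (unitary B))]

/-- The inverse Cayley transform of a unitary close to the unit. -/
lemma exists_inverse_cayley {B : Type*} [CStarAlgebra B] {u : B} (hu : u ∈ unitary B)
    (hu1 : ‖u - 1‖ ≤ 1) :
    ∃ s : B, s * (u + 1) = 1 ∧ (u + 1) * s = 1 ∧ ‖s‖ ≤ 1 ∧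
      IsSelfAdjoint ((-Complex.I) • (1 - (2 : ℂ) • s)) := by
  have hunit : IsUnit (u + 1) := by
    have h1 : IsUnit (1 - (-(2⁻¹ : ℂ)) • (u - 1)) := isUnit_one_sub_of_norm_lt_one (by
      rw [norm_smul]
      have : ‖(-(2⁻¹ : ℂ))‖ = 2⁻¹ := by simp
      rw [this]
      linarith)
    have h2 := h1.smul (Units.mk0 (2 : ℂ) two_ne_zero)
    convert h2 using 1
    rw [Units.smul_def, Units.val_mk0, smul_sub, smul_smul]
    simp [two_smul]
    abel
  obtain ⟨t, ht⟩ := hunit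
  have h1 : (↑t⁻¹ : B) * (u + 1) = 1 := by rw [← ht, Units.inv_mul]
  have h2 : (u + 1) * (↑t⁻¹ : B) = 1 := by rw [← ht, Units.mul_inv]
  set s : B := ↑t⁻¹
  refine ⟨s, h1, h2, ?_, ?_⟩
  · have h3 : (2 : ℂ) • s = 1 - s * (u - 1) := by
      have h4 : (2 : ℂ) • s = s * (u + 1) - s * (u - 1) := by
        rw [two_smul]
        noncomm_ring
      rw [h4, h1]
    have h4 : ‖(2 : ℂ) • s‖ = 2 * ‖s‖ := by rw [norm_smul]; simp
    have h5 : ‖s * (u - 1)‖ ≤ ‖s‖ * 1 := (norm_mul_le _ _).trans (by gcongr)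
    have h6 := norm_sub_le 1 (s * (u - 1))
    rw [← h3, h4] at h6
    linarith [norm_le_one_of_mem_unitary (one_mem (unitary B))]
  · have h3 : star s = u * s := by
      have h4 : star s * (star u + 1) = 1 := by
        rw [← star_one, ← star_add, ← star_mul, h2]
      calc star s = star s * ((u + 1) * s) := by rw [h2, mul_one]
        _ = star s * (star u * u + u) * s := by
          rw [Unitary.star_mul_self_of_mem hu]
          noncomm_ring
        _ = star s * (star u + 1) * (u * s) := by noncomm_ring
        _ = u * s := by rw [h4, one_mul]
    have h4 : star s = 1 - s := by
      rw [h3, eq_sub_iff_add_eq, ← h2]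
      noncomm_ring
    simp only [IsSelfAdjoint, star_smul, star_sub, star_one, h4, RCLike.star_def, map_neg,
      Complex.conj_I, map_ofNat]
    module

/-- Unitaries close to the unit lift along surjective star homomorphisms, with control on
commutators. -/
lemma exists_unitary_lift_of_norm_sub_one_le {B C ι : Type*} [CStarAlgebra B] [CStarAlgebra C]
    [Finite ι] {π : B →⋆ₐ[ℂ] C} (hπ : Function.Surjective π) {x : ι → B} (hx : ∀ i, ‖x i‖ ≤ 1)
    {u : C} (hu : u ∈ unitary C) (hu1 : ‖u - 1‖ ≤ 1) {δ : ℝ} (hδ0 : 0 < δ)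
    (hδ : ∀ i, ‖π (x i) * u - u * π (x i)‖ ≤ δ) :
    ∃ v ∈ unitary B, π v = u ∧ ∀ i, ‖x i * v - v * x i‖ ≤ 17 * δ := by
  obtain ⟨s, hs1, hs2, hs3, hsa⟩ := exists_inverse_cayley hu hu1
  obtain ⟨k, hk, hksa, hkx⟩ := exists_selfAdjoint_lift hπ hx hsa (δ := 2 * δ) (η := δ / 2)
    (fun i ↦ by
      have h1 := norm_commutator_inverse_le hs1 hs2 hs3 (π (x i))
      have h2 : π (x i) * (u + 1) - (u + 1) * π (x i) = π (x i) * u - u * π (x i) := by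
        noncomm_ring
      rw [h2] at h1
      have h3 : π (x i) * (-Complex.I) • (1 - (2 : ℂ) • s) -
          ((-Complex.I) • (1 - (2 : ℂ) • s)) * π (x i) =
          (2 * Complex.I) • (π (x i) * s - s * π (x i)) := by
        simp only [mul_smul_comm, smul_mul_assoc, mul_sub, sub_mul, mul_one, one_mul]
        module
      rw [h3, norm_smul]
      have : ‖2 * Complex.I‖ = 2 := by simp
      rw [this]
      linarith [hδ i]) (by positivity)
  obtain ⟨r, hr1, hr2, hr3, hru⟩ := hksa.exists_cayley
  refine ⟨_, hru, ?_, fun i ↦ ?_⟩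
  · have h1 : π r * ((2 : ℂ) • s) = 1 := by
      have := congrArg π hr1
      rw [map_mul, map_sub, map_smul, map_one, hk, smul_smul] at this
      simpa using this
    have h2 : (2 : ℂ) • π r = u + 1 := by
      calc (2 : ℂ) • π r = (2 : ℂ) • (π r * (s * (u + 1))) := by rw [hs1, mul_one]
        _ = (π r * ((2 : ℂ) • s)) * (u + 1) := by
          rw [mul_smul_comm, smul_mul_assoc, mul_assoc]
        _ = u + 1 := by rw [h1, one_mul]
    rw [map_sub, map_smul, h2, map_one, add_sub_cancel_right]
  · have h1 := norm_commutator_inverse_le hr1 hr2 hr3 (x i)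
    have h2 : x i * (1 - Complex.I • k) - (1 - Complex.I • k) * x i =
        (-Complex.I) • (x i * k - k * x i) := by
      simp only [mul_sub, sub_mul, mul_smul_comm, smul_mul_assoc, smul_sub, neg_smul, mul_one,
        one_mul]
      abel
    have h3 : x i * ((2 : ℂ) • r - 1) - ((2 : ℂ) • r - 1) * x i =
        (2 : ℂ) • (x i * r - r * x i) := by
      simp only [mul_sub, sub_mul, mul_smul_comm, smul_mul_assoc, smul_sub, mul_one, one_mul]
      abel
    rw [h2, norm_smul, norm_neg, Complex.norm_I, one_mul] at h1
    rw [h3, norm_smul, Complex.norm_ofNat]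
    linarith [hkx i]

lemma norm_commutator_mul_le {B : Type*} [NormedRing B] {u v : B} (hu : ‖u‖ ≤ 1) (hv : ‖v‖ ≤ 1)
    (x : B) :
    ‖x * (u * v) - u * v * x‖ ≤ ‖x * u - u * x‖ + ‖x * v - v * x‖ := by
  have : x * (u * v) - u * v * x = (x * u - u * x) * v + u * (x * v - v * x) := by noncomm_ring
  rw [this]
  calc _ ≤ ‖x * u - u * x‖ * ‖v‖ + ‖u‖ * ‖x * v - v * x‖ :=
        (norm_add_le _ _).trans (add_le_add (norm_mul_le _ _) (norm_mul_le _ _))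
    _ ≤ ‖x * u - u * x‖ * 1 + 1 * ‖x * v - v * x‖ := by gcongr
    _ = _ := by simp

lemma norm_commutator_star_mul_le {B : Type*} [CStarAlgebra B] {u v : B} (hu : u ∈ unitary B)
    (hv : v ∈ unitary B) (x : B) :
    ‖x * (star u * v) - star u * v * x‖ ≤ ‖x * u - u * x‖ + ‖x * v - v * x‖ := by
  have h := norm_le_one_of_mem_unitary (Unitary.star_mem hu)
  refine (norm_commutator_mul_le h (norm_le_one_of_mem_unitary hv) x).trans ?_
  gcongr
  exact norm_commutator_inverse_le (Unitary.star_mul_self_of_mem hu)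
    (Unitary.mul_star_self_of_mem hu) h x

lemma norm_star_mul_sub_one {B : Type*} [CStarAlgebra B] {u : B} (hu : u ∈ unitary B) (v : B) :
    ‖star u * v - 1‖ = dist v u := by
  rw [← Unitary.star_mul_self_of_mem hu, ← mul_sub,
    CStarRing.norm_mem_unitary_mul _ (Unitary.star_mem hu), dist_eq_norm]

/-- Approximately central unitary paths of finite length lift at their end points, with an error
linear in the length. -/
lemma exists_unitary_lift_of_path {B C ι : Type*} [CStarAlgebra B] [CStarAlgebra C]
    [Finite ι] {π : B →⋆ₐ[ℂ] C} (hπ : Function.Surjective π) {x : ι → B} (hx : ∀ i, ‖x i‖ ≤ 1)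
    {u : ℝ → C} (hc : ContinuousOn u (Set.Icc 0 1)) (hu : ∀ t ∈ Set.Icc (0 : ℝ) 1, u t ∈ unitary C)
    {δ : ℝ} (hδ0 : 0 < δ)
    (hδ : ∀ i, ∀ t ∈ Set.Icc (0 : ℝ) 1, ‖π (x i) * u t - u t * π (x i)‖ ≤ δ) (N : ℕ) :
    ∀ a ∈ Set.Icc (0 : ℝ) 1, eVariationOn u (Set.Icc a 1) ≤ N →
      ∃ v ∈ unitary B, π v = star (u a) * u 1 ∧
        ∀ i, ‖x i * v - v * x i‖ ≤ (N + 1) * (34 * δ) := by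
  have h1mem : (1 : ℝ) ∈ Set.Icc (0 : ℝ) 1 := by simp
  have short {a t : ℝ} (ha : a ∈ Set.Icc (0 : ℝ) 1) (ht : t ∈ Set.Icc (0 : ℝ) 1)
      (h : dist (u t) (u a) ≤ 1) : ∃ v ∈ unitary B, π v = star (u a) * u t ∧
        ∀ i, ‖x i * v - v * x i‖ ≤ 34 * δ := by
    obtain ⟨v, hv, hv1, hv2⟩ := exists_unitary_lift_of_norm_sub_one_le hπ hx
      (mul_mem (Unitary.star_mem (hu a ha)) (hu t ht))
      ((norm_star_mul_sub_one (hu a ha) _).trans_le h) (δ := 2 * δ) (by positivity) (fun i ↦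
        (norm_commutator_star_mul_le (hu a ha) (hu t ht) _).trans
          (by linarith [hδ i a ha, hδ i t ht]))
    exact ⟨v, hv, hv1, fun i ↦ (hv2 i).trans (by linarith)⟩
  induction N with
  | zero =>
    intro a ha hvar
    have h : edist (u 1) (u a) ≤ 0 :=
      (eVariationOn.edist_le u (Set.right_mem_Icc.2 ha.2) (Set.left_mem_Icc.2 ha.2)).trans
        (by simpa using hvar)
    have h' : u 1 = u a := edist_le_zero.1 h
    simpa using short ha h1mem (by rw [h', dist_self]; exact zero_le_one)
  | succ N ih =>
    intro a ha hvar
    by_cases h : dist (u 1) (u a) ≤ 1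
    · obtain ⟨v, hv, hv1, hv2⟩ := short ha h1mem h
      refine ⟨v, hv, hv1, fun i ↦ (hv2 i).trans ?_⟩
      have : (0 : ℝ) ≤ ((N + 1 : ℕ) : ℝ) := Nat.cast_nonneg _
      nlinarith
    · have hcont : ContinuousOn (fun t ↦ dist (u t) (u a)) (Set.Icc a 1) :=
        continuous_dist.comp_continuousOn
          ((hc.mono (Set.Icc_subset_Icc_left ha.1)).prodMk continuousOn_const)
      obtain ⟨t, ht, hta⟩ := intermediate_value_Icc ha.2 hcont
        (show (1 : ℝ) ∈ Set.Icc _ _ from ⟨by simp, (not_le.1 h).le⟩)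
      have ht01 : t ∈ Set.Icc (0 : ℝ) 1 := ⟨ha.1.trans ht.1, ht.2⟩
      have hsplit := eVariationOn.Icc_add_Icc u (s := Set.univ) ht.1 ht.2 (Set.mem_univ t)
      simp only [Set.univ_inter] at hsplit
      have h1 : 1 ≤ eVariationOn u (Set.Icc a t) := by
        refine le_trans ?_ (eVariationOn.edist_le u (Set.right_mem_Icc.2 ht.1)
          (Set.left_mem_Icc.2 ht.1))
        rw [edist_dist]
        simp only at hta
        rw [hta, ENNReal.ofReal_one]
      have h2 : eVariationOn u (Set.Icc t 1) ≤ N := by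
        have h3 : 1 + eVariationOn u (Set.Icc t 1) ≤ 1 + N := by
          calc _ ≤ _ := add_le_add_left h1 _
            _ ≤ _ := hsplit.trans_le hvar
            _ = 1 + N := by push_cast; rw [add_comm]
        exact (ENNReal.add_le_add_iff_left ENNReal.one_ne_top).1 h3
      obtain ⟨v, hv, hv1, hv2⟩ := short ha ht01 hta.le
      obtain ⟨v', hv', hv1', hv2'⟩ := ih t ht01 h2
      refine ⟨v * v', mul_mem hv hv', ?_, fun i ↦ ?_⟩
      · rw [map_mul, hv1, hv1', mul_assoc, ← mul_assoc (u t),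
          Unitary.mul_star_self_of_mem (hu t ht01), one_mul]
      · refine (norm_commutator_mul_le (norm_le_one_of_mem_unitary hv)
          (norm_le_one_of_mem_unitary hv') _).trans ?_
        push_cast
        linarith [hv2 i, hv2' i]

/-- An approximately central unitary in a quotient which is connected to the unit by an
approximately central rectifiable unitary path of length at most L admits an
approximately central unitary lift, with δ depending only on L, n and ε. -/
theorem approx_central_unitary_lifting
    (L : ℝ) (hL : 0 < L) (n : ℕ) (ε : ℝ) (hε : 0 < ε) :
    ∃ δ : ℝ, 0 < δ ∧
      ∀ (B C : Type)
        [NormedRing B] [StarRing B] [CStarRing B] [NormedAlgebra ℂ B]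
        [CompleteSpace B] [StarModule ℂ B]
        [NormedRing C] [StarRing C] [CStarRing C] [NormedAlgebra ℂ C]
        [CompleteSpace C] [StarModule ℂ C]
        (π : B →⋆ₐ[ℂ] C), Function.Surjective π →
        ∀ (x : Fin n → B), (∀ i, ‖x i‖ ≤ 1) →
        ∀ w : C, w ∈ unitary C →
          (∃ u : ℝ → C,
            ContinuousOn u (Set.Icc 0 1) ∧
            (∀ t ∈ Set.Icc (0 : ℝ) 1, u t ∈ unitary C) ∧
            u 0 = 1 ∧ u 1 = w ∧
            eVariationOn u (Set.Icc 0 1) ≤ ENNReal.ofReal L ∧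
            (∀ i, ∀ t ∈ Set.Icc (0 : ℝ) 1, ‖π (x i) * u t - u t * π (x i)‖ < δ)) →
          ∃ v : B, v ∈ unitary B ∧ π v = w ∧
            ∀ i, ‖x i * v - v * x i‖ < ε := by
  obtain ⟨N, hN⟩ := exists_nat_ge L
  refine ⟨ε / (68 * (N + 1)), by positivity, ?_⟩
  intro B C _ _ _ _ _ _ _ _ _ _ _ _ π hπ x hx w hw ⟨u, hc, hu, hu0, hu1, hvar, hδ⟩
  let _ : CStarAlgebra B := {}
  let _ : CStarAlgebra C := {}
  obtain ⟨v, hv, hv1, hv2⟩ := exists_unitary_lift_of_path hπ hx hc hu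
    (δ := ε / (68 * (N + 1))) (by positivity) (fun i t ht ↦ (hδ i t ht).le) N 0 (by simp)
    (hvar.trans (by
      rw [← ENNReal.ofReal_natCast]
      exact ENNReal.ofReal_le_ofReal hN))
  refine ⟨v, hv, by rw [hv1, hu0, hu1, star_one, one_mul], fun i ↦ (hv2 i).trans_lt ?_⟩
  have : ((N : ℝ) + 1) * (34 * (ε / (68 * (N + 1)))) = ε / 2 := by
    field_simp
    norm_num
  rw [this]
  linarith
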